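/- The function F⁻ = Fc − Fs satisfies −0.69 < F⁻(5π/4) ≤ F⁻(x) ≤ F⁻(9π/4) < 0.53 for all x ≥ 3π/4, and F⁻(x) > 0 for 0 < x < 3π/4 (in particular F⁻(3π/4) > 0.14). -/

import Mathlib

open Real MeasureTheory Set
open scoped Classical

noncomputable section

/-- A window function `g ∈ 𝒲`: nonnegative, even, with support `(-2/3, 2/3)`,
and whose integer translates form a partition of unity. -/
structure IsWindow (g : ℝ → ℝ) : Prop where
  nonneg : ∀ x, 0 ≤ g x
  even_fun : ∀ x, g (-x) = g x
  supp_eq : Function.support g = Ioo (-(2/3) : ℝ) (2/3)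
  partition : ∀ x : ℝ, HasSum (fun z : ℤ => g (x + (z : ℝ))) 1

/-- `g ∈ 𝒲^q`: a window function that is `q`-times continuously differentiable. -/
def IsWindowQ (g : ℝ → ℝ) (q : ℕ) : Prop := IsWindow g ∧ ContDiff ℝ q g

/-- `g̃(x) = g(x/2) - g(x)`. -/
def gtilde (g : ℝ → ℝ) : ℝ → ℝ := fun x => g (x / 2) - g x

/-- Horizontal bivariate window `Ψ^{(h)}(x) = g̃(x₁) g(x₂)`. -/
def PsiH (g : ℝ → ℝ) : ℝ × ℝ → ℝ := fun x => gtilde g x.1 * g x.2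

/-- Vertical bivariate window `Ψ^{(v)}(x) = g(x₁) g̃(x₂)`. -/
def PsiV (g : ℝ → ℝ) : ℝ × ℝ → ℝ := fun x => g x.1 * gtilde g x.2

/-- `Ψ_{j,ℓ}^{(i)}(ξ) = Ψ^{(i)}((N_{j,ℓ}^{(i)})^{-T} ξ)`, where the inverse transpose of the
shear matrices has been written out explicitly.  `i = true` is the horizontal case `(h)`,
`i = false` the vertical case `(v)`. -/
def PsiJL (g : ℝ → ℝ) (i : Bool) (j : ℕ) (ℓ : ℤ) : ℝ × ℝ → ℝ := fun ξ =>
  if i then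
    PsiH g ((2:ℝ) ^ (-(j:ℝ)) * ξ.1,
            (2:ℝ) ^ (-(j:ℝ)/2) * ξ.2 - (ℓ:ℝ) * (2:ℝ) ^ (-(j:ℝ)) * ξ.1)
  else
    PsiV g ((2:ℝ) ^ (-(j:ℝ)/2) * ξ.1 - (ℓ:ℝ) * (2:ℝ) ^ (-(j:ℝ)) * ξ.2,
            (2:ℝ) ^ (-(j:ℝ)) * ξ.2)

/-- Discrete angles `θ_{j,ℓ}^{(h)} = arctan(ℓ 2^{-j/2})`,
`θ_{j,ℓ}^{(v)} = arccot(ℓ 2^{-j/2}) = π/2 - arctan(ℓ 2^{-j/2})`. -/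
def thetaJL (i : Bool) (j : ℕ) (ℓ : ℤ) : ℝ :=
  if i then arctan ((ℓ:ℝ) * (2:ℝ) ^ (-(j:ℝ)/2))
  else π/2 - arctan ((ℓ:ℝ) * (2:ℝ) ^ (-(j:ℝ)/2))

/-- The pattern `𝒫(N_{j,ℓ}^{(i)}) = (N_{j,ℓ}^{(i)})^{-1} ℤ² ∩ [-1/2,1/2)²`:
`y` belongs to the pattern iff `N_{j,ℓ}^{(i)} y ∈ ℤ²` and `y ∈ [-1/2,1/2)²`. -/
def pattern (i : Bool) (j : ℕ) (ℓ : ℤ) : Set (ℝ × ℝ) :=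
  {y : ℝ × ℝ |
    (∃ k : ℤ × ℤ,
      (if i then ((2:ℝ)^(j:ℝ) * y.1 + (ℓ:ℝ) * (2:ℝ)^((j:ℝ)/2) * y.2, (2:ℝ)^((j:ℝ)/2) * y.2)
       else ((2:ℝ)^((j:ℝ)/2) * y.1, (ℓ:ℝ) * (2:ℝ)^((j:ℝ)/2) * y.1 + (2:ℝ)^(j:ℝ) * y.2))
        = ((k.1 : ℝ), (k.2 : ℝ)))
    ∧ y.1 ∈ Ico (-(1/2) : ℝ) (1/2) ∧ y.2 ∈ Ico (-(1/2) : ℝ) (1/2)}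

/-- `ỹ = y - (2^{-j-1},0)ᵀ` in the horizontal case, `ỹ = y - (0,2^{-j-1})ᵀ` in the vertical one. -/
def ytilde (i : Bool) (j : ℕ) (y : ℝ × ℝ) : ℝ × ℝ :=
  if i then (y.1 - (2:ℝ) ^ (-(j:ℝ) - 1), y.2) else (y.1, y.2 - (2:ℝ) ^ (-(j:ℝ) - 1))

/-- The trigonometric polynomial shearlet
`ψ_{j,ℓ,y}^{(i)}(x) = ∑_{k∈ℤ²} Ψ_{j,ℓ}^{(i)}(k) e^{i k·(x - 2πỹ)}`. -/
def shearlet (g : ℝ → ℝ) (i : Bool) (j : ℕ) (ℓ : ℤ) (y : ℝ × ℝ) : ℝ × ℝ → ℂ := fun x =>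
  ∑' k : ℤ × ℤ, (PsiJL g i j ℓ ((k.1 : ℝ), (k.2 : ℝ)) : ℂ) *
    Complex.exp (Complex.I *
      (((k.1 : ℝ) * (x.1 - 2*π*(ytilde i j y).1)
        + (k.2 : ℝ) * (x.2 - 2*π*(ytilde i j y).2) : ℝ) : ℂ))

/-- `⟨f,h⟩₂ = (2π)^{-2} ∫_{𝕋²} f(x) conj(h(x)) dx`, with the torus realised as `[-π,π]²`. -/
def inner2 (f h : ℝ × ℝ → ℂ) : ℂ :=
  ((2*π)^2 : ℂ)⁻¹ * ∫ x in (Icc (-π) π ×ˢ Icc (-π) π : Set (ℝ × ℝ)), f x * (starRingEnd ℂ) (h x)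

/-- The `2π`-periodization `f^{2π} = ∑_{n∈ℤ²} f(· + 2πn)`. -/
def periodize (f : ℝ × ℝ → ℝ) : ℝ × ℝ → ℝ := fun x =>
  ∑' n : ℤ × ℤ, f (x.1 + 2*π*(n.1 : ℝ), x.2 + 2*π*(n.2 : ℝ))

/-- Euclidean norm `|x|₂` on `ℝ²`. -/
def nrm2 (x : ℝ × ℝ) : ℝ := Real.sqrt (x.1^2 + x.2^2)

/-- First partial derivative of a complex-valued function of two real variables. -/
def pd1 (f : ℝ × ℝ → ℂ) : ℝ × ℝ → ℂ := fun x => deriv (fun t => f (t, x.2)) x.1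

/-- Second partial derivative of a complex-valued function of two real variables. -/
def pd2 (f : ℝ × ℝ → ℂ) : ℝ × ℝ → ℂ := fun x => deriv (fun t => f (x.1, t)) x.2

/-- `∂^r = ∂^{r₁+r₂}/∂x₁^{r₁}∂x₂^{r₂}` (complex-valued). -/
def pd (r : ℕ × ℕ) (f : ℝ × ℝ → ℂ) : ℝ × ℝ → ℂ := pd1^[r.1] (pd2^[r.2] f)

/-- First partial derivative of a real-valued function of two real variables. -/
def pdR1 (f : ℝ × ℝ → ℝ) : ℝ × ℝ → ℝ := fun x => deriv (fun t => f (t, x.2)) x.1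

/-- Second partial derivative of a real-valued function of two real variables. -/
def pdR2 (f : ℝ × ℝ → ℝ) : ℝ × ℝ → ℝ := fun x => deriv (fun t => f (x.1, t)) x.2

/-- `∂^r = ∂^{r₁+r₂}/∂x₁^{r₁}∂x₂^{r₂}` (real-valued). -/
def pdR (r : ℕ × ℕ) (f : ℝ × ℝ → ℝ) : ℝ × ℝ → ℝ := pdR1^[r.1] (pdR2^[r.2] f)

/-- The Fourier transform `𝓕f(x) = (2π)^{-2} ∫_{ℝ²} f(ξ) e^{-iξ·x} dξ`. -/
def FT (f : ℝ × ℝ → ℂ) : ℝ × ℝ → ℂ := fun x =>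
  ((2*π)^2 : ℂ)⁻¹ * ∫ ξ : ℝ × ℝ, f ξ * Complex.exp (-(Complex.I) * ((ξ.1*x.1 + ξ.2*x.2 : ℝ) : ℂ))

/-- Rotation matrix `R_γ` acting on `ℝ²`. -/
def rotM (γ : ℝ) (x : ℝ × ℝ) : ℝ × ℝ :=
  (Real.cos γ * x.1 - Real.sin γ * x.2, Real.sin γ * x.1 + Real.cos γ * x.2)

/-- Transposed rotation matrix `R_γᵀ` acting on `ℝ²`. -/
def rotT (γ : ℝ) (x : ℝ × ℝ) : ℝ × ℝ :=
  (Real.cos γ * x.1 + Real.sin γ * x.2, -(Real.sin γ) * x.1 + Real.cos γ * x.2)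

/-- The standard edge fragment `ℰ_j(x) = f(x) φ(2^{j/2}x) χ_{{x₁ ≥ E(x₂)}}(x)`. -/
def edgeFragment (f φ : ℝ × ℝ → ℝ) (E : ℝ → ℝ) (j : ℕ) : ℝ × ℝ → ℝ := fun x =>
  f x * φ ((2:ℝ)^((j:ℝ)/2) * x.1, (2:ℝ)^((j:ℝ)/2) * x.2) * (if E x.2 ≤ x.1 then 1 else 0)

/-- The second-order differential operator `L = I + 2^j Δ`. -/
def Lop (j : ℕ) (f : ℝ × ℝ → ℂ) : ℝ × ℝ → ℂ := fun x =>
  f x + (Complex.ofReal ((2:ℝ)^(j:ℝ))) * (pd (2,0) f x + pd (0,2) f x)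

/-- The dyadic square `Q` indexed by `(n₁,n₂)` at scale `j`. -/
def dyadicSquare (j : ℕ) (n : ℕ × ℕ) : Set (ℝ × ℝ) :=
  Ico (2*π*(n.1:ℝ)*(2:ℝ)^(-(j:ℝ)/2) - π) (2*π*((n.1:ℝ)+1)*(2:ℝ)^(-(j:ℝ)/2) - π) ×ˢ
  Ico (2*π*(n.2:ℝ)*(2:ℝ)^(-(j:ℝ)/2) - π) (2*π*((n.2:ℝ)+1)*(2:ℝ)^(-(j:ℝ)/2) - π)

/-- The indices of the dyadic squares at scale `j` meeting `∂T` (the set `𝒬_j^1`). -/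
def Q1set (T : Set (ℝ × ℝ)) (j : ℕ) : Finset (ℕ × ℕ) :=
  (Finset.range (2^(j/2)) ×ˢ Finset.range (2^(j/2))).filter
    (fun n => (frontier T ∩ dyadicSquare j n).Nonempty)

/-- Fresnel integral `Fc(x) = ∫₀ˣ cos v/√v dv`. -/
def Fc (x : ℝ) : ℝ := ∫ v in (0:ℝ)..x, Real.cos v / Real.sqrt v

/-- Fresnel integral `Fs(x) = ∫₀ˣ sin v/√v dv`. -/
def Fs (x : ℝ) : ℝ := ∫ v in (0:ℝ)..x, Real.sin v / Real.sqrt v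

/-- `F⁺ = Fc + Fs`. -/
def Fp (x : ℝ) : ℝ := Fc x + Fs x

/-- `F⁻ = Fc - Fs`. -/
def Fm (x : ℝ) : ℝ := Fc x - Fs x

/-- `a(λ,p,A)` of the paper. -/
def aInt (g : ℝ → ℝ) (l p A : ℝ) : ℝ :=
  ∫ v in Ioi (0:ℝ),
    (g (2*Real.sqrt (A*l*v) + p*l) + g (2*Real.sqrt (A*l*v) - p*l)) * (Real.cos v / Real.sqrt v)

/-- `b(λ,p,A)` of the paper. -/
def bInt (g : ℝ → ℝ) (l p A : ℝ) : ℝ :=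
  ∫ v in Ioi (0:ℝ),
    (g (2*Real.sqrt (A*l*v) + p*l) + g (2*Real.sqrt (A*l*v) - p*l)) * (Real.sin v / Real.sqrt v)

/-- `P₁(D,p,A)` of the paper. -/
def P1 (g : ℝ → ℝ) (D p A : ℝ) : ℝ :=
  ∫ l in (1/3 : ℝ)..(4/3),
    gtilde g l * l⁻¹ *
      ((aInt g l p A + bInt g l p A) * Real.cos (D*l)
        + (aInt g l p A - bInt g l p A) * Real.sin (D*l))

/-- `P₂(D,p,A)` of the paper. -/
def P2 (g : ℝ → ℝ) (D p A : ℝ) : ℝ :=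
  ∫ l in (1/3 : ℝ)..(4/3),
    gtilde g l * l⁻¹ *
      ((aInt g l p A + bInt g l p A) * Real.sin (D*l)
        - (aInt g l p A - bInt g l p A) * Real.cos (D*l))


lemma intervalIntegrable_div_sqrt {f : ℝ → ℝ} (hf : Continuous f) (a b : ℝ) (ha : 0 ≤ a)
    (hb : 0 ≤ b) : IntervalIntegrable (fun v => f v / √v) volume a b := by
  have h : IntervalIntegrable (fun v : ℝ => f v * v ^ (-(1 / 2) : ℝ)) volume a b :=
    (intervalIntegral.intervalIntegrable_rpow' (by norm_num)).continuousOn_mul hf.continuousOn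
  refine h.congr fun v hv => ?_
  have hv0 : 0 ≤ v := (le_min ha hb).trans hv.1.le
  simp only [Real.rpow_neg hv0, Real.sqrt_eq_rpow, div_eq_mul_inv]

lemma Fm_eq_integral {x : ℝ} (hx : 0 ≤ x) : Fm x = ∫ v in (0:ℝ)..x, (cos v - sin v) / √v := by
  simp only [Fm, Fc, Fs, sub_div]
  exact (intervalIntegral.integral_sub
    (intervalIntegrable_div_sqrt continuous_cos 0 x le_rfl hx)
    (intervalIntegrable_div_sqrt continuous_sin 0 x le_rfl hx)).symm

lemma hasDerivAt_Fm {x : ℝ} (hx : 0 < x) : HasDerivAt Fm ((cos x - sin x) / √x) x := by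
  have hf : Continuous fun v => cos v - sin v := continuous_cos.sub continuous_sin
  have h := intervalIntegral.integral_hasDerivAt_right
    (intervalIntegrable_div_sqrt hf 0 x le_rfl hx.le)
    (Measurable.stronglyMeasurable (by fun_prop)).stronglyMeasurableAtFilter
    (hf.continuousAt.div continuous_sqrt.continuousAt (Real.sqrt_pos.2 hx).ne')
  refine h.congr_of_eventuallyEq ?_
  filter_upwards [lt_mem_nhds hx] with y hy using Fm_eq_integral hy.le

lemma continuousOn_Fm : ContinuousOn Fm (Ioi 0) := fun _ hx =>
  (hasDerivAt_Fm hx).continuousAt.continuousWithinAt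

lemma cos_sub_sin_eq (x : ℝ) : cos x - sin x = √2 * cos (x + π / 4) := by
  rw [cos_add, cos_pi_div_four, sin_pi_div_four]
  linear_combination (-(cos x - sin x) / 2) * Real.mul_self_sqrt (zero_le_two (α := ℝ))

lemma cos_add_sin_eq (x : ℝ) : cos x + sin x = √2 * cos (x - π / 4) := by
  rw [cos_sub, cos_pi_div_four, sin_pi_div_four]
  linear_combination (-(cos x + sin x) / 2) * Real.mul_self_sqrt (zero_le_two (α := ℝ))

lemma Fm_pos_of_le_pi_div_four {x : ℝ} (hx : 0 < x) (hx' : x ≤ π / 4) : 0 < Fm x := by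
  rw [Fm_eq_integral hx.le]
  refine intervalIntegral.intervalIntegral_pos_of_pos_on
    (intervalIntegrable_div_sqrt (continuous_cos.sub continuous_sin) 0 x le_rfl hx.le)
    (fun v hv => div_pos ?_ (Real.sqrt_pos.2 hv.1)) hx
  rw [cos_sub_sin_eq]
  have := pi_pos
  exact mul_pos (by positivity)
    (cos_pos_of_mem_Ioo ⟨by linarith [hv.1], by linarith [hv.2]⟩)

lemma Fm_antitoneOn : AntitoneOn Fm (Icc (π / 4) (5 * π / 4)) := by
  have hpi := pi_pos
  refine antitoneOn_of_hasDerivWithinAt_nonpos (f' := fun x => (cos x - sin x) / √x)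
    (convex_Icc _ _) (continuousOn_Fm.mono fun x hx => ?_) (fun x hx => ?_) fun x hx => ?_
  · exact lt_of_lt_of_le (by positivity) hx.1
  · rw [interior_Icc] at hx
    exact (hasDerivAt_Fm (lt_trans (by positivity) hx.1)).hasDerivWithinAt
  · rw [interior_Icc] at hx
    refine div_nonpos_of_nonpos_of_nonneg ?_ (Real.sqrt_nonneg x)
    rw [cos_sub_sin_eq]
    exact mul_nonpos_of_nonneg_of_nonpos (Real.sqrt_nonneg 2)
      (cos_nonpos_of_pi_div_two_le_of_le (by linarith [hx.1]) (by linarith [hx.2]))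

lemma Fm_monotoneOn : MonotoneOn Fm (Icc (5 * π / 4) (9 * π / 4)) := by
  have hpi := pi_pos
  refine monotoneOn_of_hasDerivWithinAt_nonneg (f' := fun x => (cos x - sin x) / √x)
    (convex_Icc _ _) (continuousOn_Fm.mono fun x hx => ?_) (fun x hx => ?_) fun x hx => ?_
  · exact lt_of_lt_of_le (by positivity) hx.1
  · rw [interior_Icc] at hx
    exact (hasDerivAt_Fm (lt_trans (by positivity) hx.1)).hasDerivWithinAt
  · rw [interior_Icc] at hx
    refine div_nonneg ?_ (Real.sqrt_nonneg x)
    rw [cos_sub_sin_eq, ← cos_sub_two_pi]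
    exact mul_nonneg (Real.sqrt_nonneg 2)
      (cos_nonneg_of_mem_Icc ⟨by linarith [hx.1], by linarith [hx.2]⟩)

/-- Subtracting a boundary term from `F⁻` leaves a function whose derivative has the sign of
`cos + sin + c`. -/
lemma hasDerivAt_Fm_sub (c : ℝ) {x : ℝ} (hx : 0 < x) :
    HasDerivAt (fun x => Fm x - (cos x + sin x + c) / √x)
      ((cos x + sin x + c) / (2 * √x ^ 3)) x := by
  have hs : 0 < √x := Real.sqrt_pos.2 hx
  have h := (hasDerivAt_Fm hx).sub ((((hasDerivAt_cos x).add (hasDerivAt_sin x)).add_const c).div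
    (Real.hasDerivAt_sqrt hx.ne') hs.ne')
  refine h.congr_deriv ?_
  simp only [Pi.add_apply]
  field_simp
  ring

lemma abs_cos_add_sin_le (x : ℝ) : |cos x + sin x| ≤ √2 := by
  rw [cos_add_sin_eq, abs_mul, abs_of_nonneg (Real.sqrt_nonneg 2)]
  exact mul_le_of_le_one_right (Real.sqrt_nonneg 2) (abs_cos_le_one _)

lemma Fm_ge_of_ge {a x : ℝ} (ha : 0 < a) (h : cos a + sin a = -√2) (hax : a ≤ x) :
    Fm a ≤ Fm x := by
  have hmono : MonotoneOn (fun x => Fm x - (cos x + sin x + √2) / √x) (Ici a) := by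
    refine monotoneOn_of_hasDerivWithinAt_nonneg (convex_Ici a) (fun y hy => ?_)
      (f' := fun x => (cos x + sin x + √2) / (2 * √x ^ 3)) (fun y hy => ?_) fun y hy => ?_
    · exact (hasDerivAt_Fm_sub _ (ha.trans_le hy)).continuousAt.continuousWithinAt
    · rw [interior_Ici] at hy
      exact (hasDerivAt_Fm_sub _ (ha.trans hy)).hasDerivWithinAt
    · exact div_nonneg (by linarith [(abs_le.1 (abs_cos_add_sin_le y)).1]) (by positivity)
  have h1 := hmono (self_mem_Ici) hax hax
  have h2 : 0 ≤ (cos x + sin x + √2) / √x :=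
    div_nonneg (by linarith [(abs_le.1 (abs_cos_add_sin_le x)).1]) (by positivity)
  simp only [h, neg_add_cancel, zero_div, sub_zero] at h1
  linarith

lemma Fm_le_of_ge {a x : ℝ} (ha : 0 < a) (h : cos a + sin a = √2) (hax : a ≤ x) :
    Fm x ≤ Fm a := by
  have hanti : AntitoneOn (fun x => Fm x - (cos x + sin x + -√2) / √x) (Ici a) := by
    refine antitoneOn_of_hasDerivWithinAt_nonpos (convex_Ici a) (fun y hy => ?_)
      (f' := fun x => (cos x + sin x + -√2) / (2 * √x ^ 3)) (fun y hy => ?_) fun y hy => ?_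
    · exact (hasDerivAt_Fm_sub _ (ha.trans_le hy)).continuousAt.continuousWithinAt
    · rw [interior_Ici] at hy
      exact (hasDerivAt_Fm_sub _ (ha.trans hy)).hasDerivWithinAt
    · exact div_nonpos_of_nonpos_of_nonneg
        (by linarith [(abs_le.1 (abs_cos_add_sin_le y)).2]) (by positivity)
  have h1 := hanti (self_mem_Ici) hax hax
  have h2 : (cos x + sin x + -√2) / √x ≤ 0 :=
    div_nonpos_of_nonpos_of_nonneg
      (by linarith [(abs_le.1 (abs_cos_add_sin_le x)).2]) (by positivity)
  simp only [h, add_neg_cancel, zero_div, sub_zero] at h1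
  linarith

lemma abs_Fm_sub_le {a b : ℝ} (ha : 1 ≤ a) (hb : 1 ≤ b) : |Fm a - Fm b| ≤ 2 * |a - b| := by
  refine (convex_Ici (1:ℝ)).norm_image_sub_le_of_norm_hasDerivWithin_le
    (f' := fun x => (cos x - sin x) / √x) (fun x hx => ?_) (fun x hx => ?_) hb ha
  · exact (hasDerivAt_Fm (zero_lt_one.trans_le hx)).hasDerivWithinAt
  · have hs : 1 ≤ √x := Real.one_le_sqrt.2 hx
    rw [Real.norm_eq_abs, abs_div, abs_of_nonneg (Real.sqrt_nonneg x)]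
    refine (div_le_self (abs_nonneg _) hs).trans ((abs_sub _ _).trans ?_)
    linarith [abs_cos_le_one x, abs_sin_le_one x]

/-- The `m`-th derivative of `cos - sin` at the origin. -/
def cosSubSinCoeff (m : ℕ) : ℝ := ((1 + Complex.I) * Complex.I ^ m).re

lemma cosSubSinCoeff_zero : cosSubSinCoeff 0 = 1 := by simp [cosSubSinCoeff]

lemma cosSubSinCoeff_one : cosSubSinCoeff 1 = -1 := by simp [cosSubSinCoeff]

lemma cosSubSinCoeff_add_two (m : ℕ) : cosSubSinCoeff (m + 2) = -cosSubSinCoeff m := by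
  simp [cosSubSinCoeff, pow_add]

lemma abs_cos_sub_sin_sub_sum_le {v : ℝ} (hv : 0 ≤ v) {n : ℕ} (hn : v / n.succ ≤ 1 / 2) :
    |cos v - sin v - ∑ m ∈ Finset.range n, cosSubSinCoeff m / m.factorial * v ^ m|
      ≤ 4 * (v ^ n / n.factorial) := by
  have hnorm : ‖(v : ℂ) * Complex.I‖ = v := by simp [abs_of_nonneg hv]
  have h := Complex.exp_bound' (x := v * Complex.I) (n := n) (by rwa [hnorm])
  rw [hnorm] at h
  have hI : ‖1 + Complex.I‖ ≤ 2 := (norm_add_le _ _).trans (by norm_num)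
  have key : cos v - sin v - ∑ m ∈ Finset.range n, cosSubSinCoeff m / m.factorial * v ^ m
      = ((1 + Complex.I) * (Complex.exp (v * Complex.I) -
        ∑ m ∈ Finset.range n, (v * Complex.I) ^ m / m.factorial)).re := by
    rw [mul_sub, Complex.sub_re, Finset.mul_sum, Complex.re_sum]
    congr 1
    · simp [Complex.exp_mul_I, ← Complex.ofReal_cos, ← Complex.ofReal_sin]
    · refine Finset.sum_congr rfl fun m _ => ?_
      have : (1 + Complex.I) * ((v * Complex.I) ^ m / m.factorial)
          = ((v ^ m / m.factorial : ℝ) : ℂ) * ((1 + Complex.I) * Complex.I ^ m) := by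
        push_cast
        ring
      rw [this, Complex.re_ofReal_mul, cosSubSinCoeff]
      ring
  rw [key]
  refine (Complex.abs_re_le_norm _).trans ?_
  rw [norm_mul]
  calc _ ≤ 2 * (v ^ n / n.factorial * 2) := by gcongr
    _ = _ := by ring

lemma integral_pow_div_sqrt (m : ℕ) {x : ℝ} (hx : 0 < x) :
    ∫ v in (0:ℝ)..x, v ^ m / √v = √x * (x ^ m / (m + 1 / 2)) := by
  have hm : (-1 : ℝ) < m - 1 / 2 := by linarith [(Nat.cast_nonneg m : (0:ℝ) ≤ m)]
  have h : ∫ v in (0:ℝ)..x, v ^ m / √v = ∫ v in (0:ℝ)..x, v ^ ((m : ℝ) - 1 / 2) := by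
    refine intervalIntegral.integral_congr_ae (Filter.Eventually.of_forall fun v hv => ?_)
    rw [uIoc_of_le hx.le] at hv
    rw [Real.rpow_sub hv.1, Real.rpow_natCast, Real.sqrt_eq_rpow]
  rw [h, integral_rpow (Or.inl hm), show (m : ℝ) - 1 / 2 + 1 = m + 1 / 2 by ring,
    Real.zero_rpow (by positivity), Real.rpow_add hx, Real.rpow_natCast, Real.sqrt_eq_rpow]
  ring

lemma abs_Fm_sub_sum_le {x : ℝ} (hx : 0 < x) {n : ℕ} (hn : x / n.succ ≤ 1 / 2) :
    |Fm x - √x * ∑ m ∈ Finset.range n, cosSubSinCoeff m / m.factorial * (x ^ m / (m + 1 / 2))|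
      ≤ √x * (8 * (x ^ n / n.factorial)) := by
  set T : ℝ → ℝ := fun v => ∑ m ∈ Finset.range n, cosSubSinCoeff m / m.factorial * v ^ m with hT
  have hTc : Continuous T := by fun_prop
  have hf : Continuous fun v => cos v - sin v := continuous_cos.sub continuous_sin
  have hTi : ∫ v in (0:ℝ)..x, T v / √v = √x *
      ∑ m ∈ Finset.range n, cosSubSinCoeff m / m.factorial * (x ^ m / (m + 1 / 2)) := by
    simp only [hT, Finset.sum_div, mul_div_assoc]
    rw [intervalIntegral.integral_finsetSum, Finset.mul_sum]
    · refine Finset.sum_congr rfl fun m _ => ?_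
      rw [intervalIntegral.integral_const_mul, integral_pow_div_sqrt m hx]
      ring
    · exact fun m _ =>
        (intervalIntegrable_div_sqrt (continuous_pow m) 0 x le_rfl hx.le).const_mul _
  have hone : ∫ v in (0:ℝ)..x, 4 * (x ^ n / n.factorial) / √v
      = √x * (8 * (x ^ n / n.factorial)) := by
    have := integral_pow_div_sqrt 0 hx
    simp only [pow_zero, Nat.cast_zero, zero_add] at this
    simp only [div_eq_mul_one_div (4 * (x ^ n / (n.factorial : ℝ)))]
    rw [intervalIntegral.integral_const_mul, this]
    ring
  rw [← hTi, Fm_eq_integral hx.le, ← intervalIntegral.integral_sub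
    (intervalIntegrable_div_sqrt hf 0 x le_rfl hx.le)
    (intervalIntegrable_div_sqrt hTc 0 x le_rfl hx.le), ← hone, ← Real.norm_eq_abs]
  refine intervalIntegral.norm_integral_le_of_norm_le hx.le
    (Filter.Eventually.of_forall fun v hv => ?_)
    (intervalIntegrable_div_sqrt continuous_const 0 x le_rfl hx.le)
  rw [← sub_div, Real.norm_eq_abs, abs_div, abs_of_nonneg (Real.sqrt_nonneg v)]
  gcongr
  have hvn : v / n.succ ≤ 1 / 2 := le_trans (by gcongr; exact hv.2) hn
  refine (abs_cos_sub_sin_sub_sum_le hv.1.le hvn).trans ?_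
  have := hv.1.le
  have := hv.2
  gcongr

lemma Fm_three_pi_div_four_bounds : 0.142 < Fm (3 * π / 4) ∧ Fm (3 * π / 4) < 0.145 := by
  have h := abs_le.1 (abs_Fm_sub_sum_le (x := 2.356) (n := 28) (by norm_num) (by norm_num))
  have hd := abs_le.1 (abs_Fm_sub_le (a := 3 * π / 4) (b := 2.356)
    (by linarith [pi_gt_d6]) (by norm_num))
  have hpi : |3 * π / 4 - 2.356| ≤ 0.0002 :=
    abs_le.2 ⟨by linarith [pi_gt_d6], by linarith [pi_lt_d6]⟩
  have hs1 : 1.5349 < √(2.356 : ℝ) := Real.lt_sqrt_of_sq_lt (by norm_num)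
  have hs2 : √(2.356 : ℝ) < 1.535 := (Real.sqrt_lt' (by norm_num)).2 (by norm_num)
  norm_num [Finset.sum_range_succ, cosSubSinCoeff_zero, cosSubSinCoeff_one,
    cosSubSinCoeff_add_two, Nat.factorial] at h hd hpi hs1 hs2 ⊢
  constructor <;> linarith

lemma lt_Fm_five_pi_div_four : -0.69 < Fm (5 * π / 4) := by
  have h := abs_le.1 (abs_Fm_sub_sum_le (x := 3.927) (n := 28) (by norm_num) (by norm_num))
  have hd := abs_le.1 (abs_Fm_sub_le (a := 5 * π / 4) (b := 3.927)
    (by linarith [pi_gt_d6]) (by norm_num))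
  have hpi : |5 * π / 4 - 3.927| ≤ 0.0001 :=
    abs_le.2 ⟨by linarith [pi_gt_d6], by linarith [pi_lt_d6]⟩
  have hs2 : √(3.927 : ℝ) < 1.9817 := (Real.sqrt_lt' (by norm_num)).2 (by norm_num)
  norm_num [Finset.sum_range_succ, cosSubSinCoeff_zero, cosSubSinCoeff_one,
    cosSubSinCoeff_add_two, Nat.factorial] at h hd hpi hs2 ⊢
  linarith

lemma Fm_nine_pi_div_four_bounds : 0.52 < Fm (9 * π / 4) ∧ Fm (9 * π / 4) < 0.53 := by
  have h := abs_le.1 (abs_Fm_sub_sum_le (x := 7.07) (n := 28) (by norm_num) (by norm_num))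
  have hd := abs_le.1 (abs_Fm_sub_le (a := 9 * π / 4) (b := 7.07)
    (by linarith [pi_gt_d6]) (by norm_num))
  have hpi : |9 * π / 4 - 7.07| ≤ 0.0015 :=
    abs_le.2 ⟨by linarith [pi_gt_d6], by linarith [pi_lt_d6]⟩
  have hs1 : 2.6589 < √(7.07 : ℝ) := Real.lt_sqrt_of_sq_lt (by norm_num)
  have hs2 : √(7.07 : ℝ) < 2.659 := (Real.sqrt_lt' (by norm_num)).2 (by norm_num)
  norm_num [Finset.sum_range_succ, cosSubSinCoeff_zero, cosSubSinCoeff_one,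
    cosSubSinCoeff_add_two, Nat.factorial] at h hd hpi hs1 hs2 ⊢
  constructor <;> linarith

/-- Bounds for `F⁻ = Fc − Fs`:
`−0.69 < F⁻(5π/4) ≤ F⁻(x) ≤ F⁻(9π/4) < 0.53` for all `x ≥ 3π/4`, and `F⁻(x) > 0`
for `0 < x < 3π/4` (in particular `F⁻(3π/4) > 0.14`). -/
theorem Fm_bounds :
    (∀ x : ℝ, 3*π/4 ≤ x → Fm (5*π/4) ≤ Fm x ∧ Fm x ≤ Fm (9*π/4)) ∧
    (-0.69 < Fm (5*π/4)) ∧ (Fm (9*π/4) < 0.53) ∧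
    (∀ x : ℝ, 0 < x → x < 3*π/4 → 0 < Fm x) ∧
    (0.14 < Fm (3*π/4)) := by
  have hpi := pi_pos
  obtain ⟨h3l, h3u⟩ := Fm_three_pi_div_four_bounds
  obtain ⟨h9l, h9u⟩ := Fm_nine_pi_div_four_bounds
  refine ⟨fun x hx => ⟨?_, ?_⟩, lt_Fm_five_pi_div_four, h9u, fun x hx0 hx => ?_, by linarith⟩
  · rcases le_total x (5 * π / 4) with h | h
    · exact Fm_antitoneOn ⟨by linarith, h⟩ ⟨by linarith, le_rfl⟩ h
    · refine Fm_ge_of_ge (by positivity) ?_ h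
      rw [cos_add_sin_eq, show 5 * π / 4 - π / 4 = π by ring, cos_pi, mul_neg_one]
  · rcases le_total x (5 * π / 4) with h | h
    · have := Fm_antitoneOn (a := 3 * π / 4) (b := x) ⟨by linarith, by linarith⟩
        ⟨by linarith, h⟩ hx
      linarith
    rcases le_total x (9 * π / 4) with h' | h'
    · exact Fm_monotoneOn ⟨h, h'⟩ ⟨by linarith, le_rfl⟩ h'
    · refine Fm_le_of_ge (by positivity) ?_ h'
      rw [cos_add_sin_eq, show 9 * π / 4 - π / 4 = 2 * π by ring, cos_two_pi, mul_one]
  · rcases le_total x (π / 4) with h | h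
    · exact Fm_pos_of_le_pi_div_four hx0 h
    · have := Fm_antitoneOn (a := x) (b := 3 * π / 4) ⟨h, by linarith⟩
        ⟨by linarith, by linarith⟩ hx.le
      linarith
end
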